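/- Let a, b, c, d ∈ ℂ and a', b', c', d' ∈ ℂ be such that a², b², c², d² are pairwise distinct and a'², b'², c'², d'² are pairwise distinct. Then there exist invertible 2×2 complex matrices O₁, O₂, O₃, O₄ with (O₁ ⊗ O₂ ⊗ O₃ ⊗ O₄) · G_{abcd} = G_{a'b'c'd'} if and only if there exist a nonzero scalar κ ∈ ℂ, a permutation σ of the four indices, and signs ε₁, ε₂, ε₃, ε₄ ∈ {1, −1} with ε₁·ε₂·ε₃·ε₄ = 1, such that (a', b', c', d') = κ·(ε₁·v_{σ(1)}, ε₂·v_{σ(2)}, ε₃·v_{σ(3)}, ε₄·v_{σ(4)}) where (v₁,v₂,v₃,v₄) = (a,b,c,d). (Proposition 1: two generic G_{abcd} states are SLOCC-equivalent iff their coefficient tuples are related by an overall scalar, a permutation, and a change of sign of an even number of coefficients.) -/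

import Mathlib

/-- The index set of four-qubit basis states. -/
abbrev QIdx4 := Fin 2 × Fin 2 × Fin 2 × Fin 2

/-- The four-qubit state `G_{abcd}`. -/
noncomputable def Gstate (a b c d : ℂ) : QIdx4 → ℂ := fun x =>
  if x = (0, 0, 0, 0) ∨ x = (1, 1, 1, 1) then (a + d) / 2
  else if x = (0, 0, 1, 1) ∨ x = (1, 1, 0, 0) then (a - d) / 2
  else if x = (0, 1, 0, 1) ∨ x = (1, 0, 1, 0) then (b + c) / 2
  else if x = (0, 1, 1, 0) ∨ x = (1, 0, 0, 1) then (b - c) / 2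
  else 0

/-- The action of the local operator `O₁ ⊗ O₂ ⊗ O₃ ⊗ O₄` on four-qubit vectors
(multiplication by the Kronecker product matrix). -/
noncomputable def act4 (O₁ O₂ O₃ O₄ : Matrix (Fin 2) (Fin 2) ℂ) (v : QIdx4 → ℂ) :
    QIdx4 → ℂ := fun x =>
  ∑ y : QIdx4, O₁ x.1 y.1 * O₂ x.2.1 y.2.1 * O₃ x.2.2.1 y.2.2.1 * O₄ x.2.2.2 y.2.2.2 * v y

open scoped Kronecker

/-- `Gstate` with its coefficients collected in a vector. -/
noncomputable def Gvec (v : Fin 4 → ℂ) : QIdx4 → ℂ := Gstate (v 0) (v 1) (v 2) (v 3)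

/-- SLOCC-equivalence of four-qubit states. -/
def SloccEquiv (x y : QIdx4 → ℂ) : Prop :=
  ∃ O₁ O₂ O₃ O₄ : Matrix (Fin 2) (Fin 2) ℂ,
    IsUnit O₁ ∧ IsUnit O₂ ∧ IsUnit O₃ ∧ IsUnit O₄ ∧ act4 O₁ O₂ O₃ O₄ x = y

theorem act4_eq_mulVec (O₁ O₂ O₃ O₄ : Matrix (Fin 2) (Fin 2) ℂ) (x : QIdx4 → ℂ) :
    act4 O₁ O₂ O₃ O₄ x = (O₁ ⊗ₖ (O₂ ⊗ₖ (O₃ ⊗ₖ O₄))).mulVec x := by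
  funext i
  simp only [act4, Matrix.mulVec, dotProduct, Matrix.kroneckerMap_apply, mul_assoc]

theorem SloccEquiv.refl (x : QIdx4 → ℂ) : SloccEquiv x x :=
  ⟨1, 1, 1, 1, isUnit_one, isUnit_one, isUnit_one, isUnit_one, by
    simp [act4_eq_mulVec]⟩

theorem SloccEquiv.trans {x y z : QIdx4 → ℂ} (hxy : SloccEquiv x y) (hyz : SloccEquiv y z) :
    SloccEquiv x z := by
  obtain ⟨A₁, A₂, A₃, A₄, h₁, h₂, h₃, h₄, rfl⟩ := hxy
  obtain ⟨B₁, B₂, B₃, B₄, k₁, k₂, k₃, k₄, rfl⟩ := hyz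
  refine ⟨B₁ * A₁, B₂ * A₂, B₃ * A₃, B₄ * A₄, k₁.mul h₁, k₂.mul h₂, k₃.mul h₃, k₄.mul h₄, ?_⟩
  simp only [act4_eq_mulVec, Matrix.mul_kronecker_mul, Matrix.mulVec_mulVec]

/-! ### Coefficient changes realized by local operators -/

/-- The permutations of the coefficients realized by local operators. -/
def coeffPerms : Submonoid (Equiv.Perm (Fin 4)) where
  carrier := {σ | ∀ v, SloccEquiv (Gvec v) (Gvec (v ∘ σ))}
  one_mem' _ := SloccEquiv.refl _
  mul_mem' {σ _} hσ hτ v := (hσ v).trans (hτ (v ∘ σ))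

/-- The rescalings of the coefficients realized by local operators. -/
def coeffScalings : Submonoid (Fin 4 → ℂ) where
  carrier := {δ | ∀ v, SloccEquiv (Gvec v) (Gvec (δ * v))}
  one_mem' v := by simpa using SloccEquiv.refl (Gvec v)
  mul_mem' {δ η} hδ hη v := by
    rw [mul_comm δ η, mul_assoc]
    exact (hδ v).trans (hη (δ * v))

theorem swap_zero_one_mem_coeffPerms : Equiv.swap 0 1 ∈ coeffPerms := by
  intro v
  refine ⟨!![1 / 4, Complex.I / 4; Complex.I / 4, 1 / 4], !![1, Complex.I; Complex.I, 1],
    !![1, -Complex.I; -Complex.I, 1], !![1, -Complex.I; -Complex.I, 1], ?_, ?_, ?_, ?_, ?_⟩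
  iterate 4
    · rw [Matrix.isUnit_iff_isUnit_det, isUnit_iff_ne_zero, Matrix.det_fin_two_of]
      ring_nf
      norm_num [Complex.I_sq]
  · funext ⟨i, j, k, l⟩
    fin_cases i <;> fin_cases j <;> fin_cases k <;> fin_cases l <;>
      simp [act4, Gvec, Gstate, Fintype.sum_prod_type, Equiv.swap_apply_def] <;>
      ring_nf <;> simp [Complex.I_sq] <;> ring

theorem swap_one_two_mem_coeffPerms : Equiv.swap 1 2 ∈ coeffPerms := by
  intro v
  refine ⟨!![1, 0; 0, Complex.I], !![1, 0; 0, -Complex.I],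
    !![1, 0; 0, -Complex.I], !![1, 0; 0, Complex.I], ?_, ?_, ?_, ?_, ?_⟩
  iterate 4
    · rw [Matrix.isUnit_iff_isUnit_det, isUnit_iff_ne_zero, Matrix.det_fin_two_of]
      ring_nf
      norm_num [Complex.I_sq]
  · funext ⟨i, j, k, l⟩
    fin_cases i <;> fin_cases j <;> fin_cases k <;> fin_cases l <;>
      simp [act4, Gvec, Gstate, Fintype.sum_prod_type, Equiv.swap_apply_def] <;> ring

theorem swap_two_three_mem_coeffPerms : Equiv.swap 2 3 ∈ coeffPerms := by
  intro v
  refine ⟨!![1 / 4, Complex.I / 4; Complex.I / 4, 1 / 4], !![1, -Complex.I; -Complex.I, 1],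
    !![1, -Complex.I; -Complex.I, 1], !![1, Complex.I; Complex.I, 1], ?_, ?_, ?_, ?_, ?_⟩
  iterate 4
    · rw [Matrix.isUnit_iff_isUnit_det, isUnit_iff_ne_zero, Matrix.det_fin_two_of]
      ring_nf
      norm_num [Complex.I_sq]
  · funext ⟨i, j, k, l⟩
    fin_cases i <;> fin_cases j <;> fin_cases k <;> fin_cases l <;>
      simp [act4, Gvec, Gstate, Fintype.sum_prod_type, Equiv.swap_apply_def] <;>
      ring_nf <;> simp [Complex.I_sq] <;> ring

theorem coeffPerms_eq_top : coeffPerms = ⊤ := by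
  rw [eq_top_iff, ← Equiv.Perm.mclosure_swap_castSucc_succ 3, Submonoid.closure_le]
  rintro _ ⟨i, rfl⟩
  fin_cases i
  · exact swap_zero_one_mem_coeffPerms
  · exact swap_one_two_mem_coeffPerms
  · exact swap_two_three_mem_coeffPerms

theorem const_mem_coeffScalings {κ : ℂ} (hκ : κ ≠ 0) : (fun _ => κ) ∈ coeffScalings := by
  intro v
  refine ⟨!![κ, 0; 0, κ], !![1, 0; 0, 1], !![1, 0; 0, 1], !![1, 0; 0, 1], ?_, ?_, ?_, ?_, ?_⟩
  · rw [Matrix.isUnit_iff_isUnit_det, isUnit_iff_ne_zero, Matrix.det_fin_two_of]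
    simp [hκ]
  iterate 3 exact Matrix.one_fin_two (α := ℂ) ▸ isUnit_one
  · funext ⟨i, j, k, l⟩
    fin_cases i <;> fin_cases j <;> fin_cases k <;> fin_cases l <;>
      simp [act4, Gvec, Gstate, Fintype.sum_prod_type] <;> ring

theorem flip_one_two_mem_coeffScalings : ![1, -1, -1, 1] ∈ coeffScalings := by
  intro v
  refine ⟨!![1, 0; 0, -1], !![1, 0; 0, -1], !![1, 0; 0, 1], !![1, 0; 0, 1], ?_, ?_, ?_, ?_, ?_⟩
  iterate 4
    · rw [Matrix.isUnit_iff_isUnit_det, isUnit_iff_ne_zero, Matrix.det_fin_two_of]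
      ring_nf
      norm_num [Complex.I_sq]
  · funext ⟨i, j, k, l⟩
    fin_cases i <;> fin_cases j <;> fin_cases k <;> fin_cases l <;>
      simp [act4, Gvec, Gstate, Fintype.sum_prod_type] <;> ring

theorem flip_two_three_mem_coeffScalings : ![1, 1, -1, -1] ∈ coeffScalings := by
  intro v
  refine ⟨!![0, 1; 1, 0], !![0, 1; 1, 0], !![1, 0; 0, 1], !![1, 0; 0, 1], ?_, ?_, ?_, ?_, ?_⟩
  iterate 4
    · rw [Matrix.isUnit_iff_isUnit_det, isUnit_iff_ne_zero, Matrix.det_fin_two_of]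
      ring_nf
      norm_num [Complex.I_sq]
  · funext ⟨i, j, k, l⟩
    fin_cases i <;> fin_cases j <;> fin_cases k <;> fin_cases l <;>
      simp [act4, Gvec, Gstate, Fintype.sum_prod_type] <;> ring

theorem signs_mem_coeffScalings {ε : Fin 4 → ℂ} (hε : ∀ i, ε i = 1 ∨ ε i = -1)
    (hprod : ∏ i, ε i = 1) : ε ∈ coeffScalings := by
  have h₀ : ε 0 ≠ 0 := by rcases hε 0 with h | h <;> simp [h]
  have key : ε = (fun _ => ε 0) * ((if ε 0 = ε 1 then 1 else ![1, -1, -1, 1]) *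
      (if ε 0 = ε 3 then 1 else ![1, 1, -1, -1])) := by
    rw [Fin.prod_univ_four] at hprod
    have h1 : (1 : ℂ) ≠ -1 := by norm_num
    rcases hε 0 with e0 | e0 <;> rcases hε 1 with e1 | e1 <;> rcases hε 2 with e2 | e2 <;>
      rcases hε 3 with e3 | e3 <;> simp only [e0, e1, e2, e3] at hprod ⊢ <;>
      first
        | (exfalso; norm_num at hprod; done)
        | (funext i; fin_cases i <;> simp [e0, e1, e2, e3, h1, h1.symm])
  rw [key]
  refine mul_mem (const_mem_coeffScalings h₀) (mul_mem ?_ ?_)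
  · split_ifs
    exacts [one_mem _, flip_one_two_mem_coeffScalings]
  · split_ifs
    exacts [one_mem _, flip_two_three_mem_coeffScalings]

/-! ### Invariants of local operators -/

/-- A four-qubit state as a matrix from the last two qubits to the first two. -/
def stateMatrix (x : QIdx4 → ℂ) : Matrix (Fin 2 × Fin 2) (Fin 2 × Fin 2) ℂ :=
  Matrix.of fun i j => x (i.1, i.2, j.1, j.2)

theorem stateMatrix_act4 (O₁ O₂ O₃ O₄ : Matrix (Fin 2) (Fin 2) ℂ) (x : QIdx4 → ℂ) :
    stateMatrix (act4 O₁ O₂ O₃ O₄ x) = (O₁ ⊗ₖ O₂) * stateMatrix x * (O₃ ⊗ₖ O₄).transpose := by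
  ext i j
  simp only [stateMatrix, act4, Matrix.of_apply, Matrix.mul_apply, Matrix.transpose_apply,
    Matrix.kroneckerMap_apply, Fintype.sum_prod_type, Fin.sum_univ_two]
  ring

/-- The Bell vectors, as the columns of a matrix. -/
def bellMatrix : Matrix (Fin 2 × Fin 2) (Fin 4) ℂ :=
  Matrix.of fun i => !![1, 0, 0, 1; 0, 1, 1, 0; 0, 1, -1, 0; 1, 0, 0, -1] (finProdFinEquiv i)

/-- The inverse of `bellMatrix`. -/
noncomputable def bellInv : Matrix (Fin 4) (Fin 2 × Fin 2) ℂ := (1 / 2 : ℂ) • bellMatrix.transpose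

theorem bellMatrix_mul_bellInv : bellMatrix * bellInv = 1 := by
  ext ⟨i, j⟩ ⟨k, l⟩
  fin_cases i <;> fin_cases j <;> fin_cases k <;> fin_cases l <;>
    simp [bellMatrix, bellInv, Matrix.mul_apply, Fin.sum_univ_four, finProdFinEquiv] <;> norm_num

theorem bellInv_mul_bellMatrix : bellInv * bellMatrix = 1 := by
  ext i j
  fin_cases i <;> fin_cases j <;>
    simp [bellMatrix, bellInv, Matrix.mul_apply, Fintype.sum_prod_type, finProdFinEquiv] <;>
    norm_num

/-- The operator that is diagonal in the Bell basis. -/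
noncomputable def bellDiagonal (v : Fin 4 → ℂ) : Matrix (Fin 2 × Fin 2) (Fin 2 × Fin 2) ℂ :=
  bellMatrix * Matrix.diagonal v * bellInv

theorem bellDiagonal_mul (v w : Fin 4 → ℂ) :
    bellDiagonal v * bellDiagonal w = bellDiagonal (v * w) := by
  have : Matrix.diagonal (v * w) = Matrix.diagonal v * (bellInv * bellMatrix) *
      Matrix.diagonal w := by
    rw [bellInv_mul_bellMatrix, Matrix.mul_one, Matrix.diagonal_mul_diagonal]
    rfl
  simp only [bellDiagonal, this, Matrix.mul_assoc]

theorem bellDiagonal_sub (v w : Fin 4 → ℂ) :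
    bellDiagonal v - bellDiagonal w = bellDiagonal (v - w) := by
  simp only [bellDiagonal, ← Matrix.sub_mul, ← Matrix.mul_sub, Matrix.diagonal_sub]
  rfl

theorem smul_bellDiagonal (s : ℂ) (v : Fin 4 → ℂ) :
    s • bellDiagonal v = bellDiagonal (s • v) := by
  simp [bellDiagonal, Matrix.diagonal_smul]

theorem transpose_bellDiagonal (v : Fin 4 → ℂ) :
    (bellDiagonal v).transpose = bellDiagonal v := by
  simp [bellDiagonal, bellInv, Matrix.transpose_mul, Matrix.mul_assoc]

theorem det_bellDiagonal (v : Fin 4 → ℂ) : (bellDiagonal v).det = ∏ i, v i := by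
  rw [bellDiagonal, Matrix.det_conj_of_mul_eq_one bellMatrix_mul_bellInv bellInv_mul_bellMatrix,
    Matrix.det_diagonal]

theorem stateMatrix_Gvec (v : Fin 4 → ℂ) : stateMatrix (Gvec v) = bellDiagonal v := by
  ext ⟨i, j⟩ ⟨k, l⟩
  fin_cases i <;> fin_cases j <;> fin_cases k <;> fin_cases l <;>
    simp [stateMatrix, Gvec, Gstate, bellDiagonal, bellMatrix, bellInv, Matrix.mul_apply,
      Fin.sum_univ_four, finProdFinEquiv, Matrix.diagonal_apply] <;> ring

/-- The symplectic form on one qubit. -/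
def symplecticJ : Matrix (Fin 2) (Fin 2) ℂ := !![0, 1; -1, 0]

theorem mul_symplecticJ_mul_transpose (A : Matrix (Fin 2) (Fin 2) ℂ) :
    A * symplecticJ * A.transpose = A.det • symplecticJ := by
  ext i j
  fin_cases i <;> fin_cases j <;>
    simp [symplecticJ, Matrix.mul_apply, Fin.sum_univ_two, Matrix.det_fin_two] <;> ring

theorem kronecker_mul_form_mul_transpose (A B : Matrix (Fin 2) (Fin 2) ℂ) :
    (A ⊗ₖ B) * (symplecticJ ⊗ₖ symplecticJ) * (A ⊗ₖ B).transpose =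
      (A.det * B.det) • (symplecticJ ⊗ₖ symplecticJ) := by
  rw [← Matrix.mul_kronecker_mul, ← Matrix.kroneckerMap_transpose, ← Matrix.mul_kronecker_mul,
    mul_symplecticJ_mul_transpose, mul_symplecticJ_mul_transpose, Matrix.smul_kronecker,
    Matrix.kronecker_smul, smul_smul]

theorem transpose_kronecker_mul_form_mul (A B : Matrix (Fin 2) (Fin 2) ℂ) :
    (A ⊗ₖ B).transpose * (symplecticJ ⊗ₖ symplecticJ) * (A ⊗ₖ B) =
      (A.det * B.det) • (symplecticJ ⊗ₖ symplecticJ) := by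
  have h := kronecker_mul_form_mul_transpose A.transpose B.transpose
  rwa [Matrix.det_transpose, Matrix.det_transpose, Matrix.kroneckerMap_transpose,
    Matrix.transpose_transpose] at h

theorem form_eq_bellDiagonal : symplecticJ ⊗ₖ symplecticJ = bellDiagonal ![1, -1, 1, -1] := by
  ext ⟨i, j⟩ ⟨k, l⟩
  fin_cases i <;> fin_cases j <;> fin_cases k <;> fin_cases l <;>
    simp [symplecticJ, bellDiagonal, bellMatrix, bellInv, Matrix.mul_apply,
      Fin.sum_univ_four, finProdFinEquiv, Matrix.diagonal_apply] <;> norm_num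

theorem det_stateMatrix_pencil (v : Fin 4 → ℂ) (s : ℂ) :
    (stateMatrix (Gvec v) * (symplecticJ ⊗ₖ symplecticJ) * (stateMatrix (Gvec v)).transpose -
      s • (symplecticJ ⊗ₖ symplecticJ)).det = ∏ i, (v i ^ 2 - s) := by
  rw [stateMatrix_Gvec, transpose_bellDiagonal, form_eq_bellDiagonal, bellDiagonal_mul,
    bellDiagonal_mul, smul_bellDiagonal, bellDiagonal_sub, det_bellDiagonal]
  simp [Fin.prod_univ_four]
  ring

theorem det_kronecker_fin_two (A B : Matrix (Fin 2) (Fin 2) ℂ) :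
    (A ⊗ₖ B).det = (A.det * B.det) ^ 2 := by
  simp [Matrix.det_kronecker, mul_pow]

theorem SloccEquiv.exists_scalar {v w : Fin 4 → ℂ} (h : SloccEquiv (Gvec v) (Gvec w)) :
    ∃ p : ℂ, p ≠ 0 ∧ (∀ s, ∏ i, (w i ^ 2 - p * s) = p ^ 4 * ∏ i, (v i ^ 2 - s)) ∧
      ∏ i, w i = p ^ 2 * ∏ i, v i := by
  obtain ⟨O₁, O₂, O₃, O₄, h₁, h₂, h₃, h₄, h⟩ := h
  rw [Matrix.isUnit_iff_isUnit_det, isUnit_iff_ne_zero] at h₁ h₂ h₃ h₄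
  have hM : stateMatrix (Gvec w) =
      (O₁ ⊗ₖ O₂) * stateMatrix (Gvec v) * (O₃ ⊗ₖ O₄).transpose := by
    rw [← h, stateMatrix_act4]
  refine ⟨O₁.det * O₂.det * (O₃.det * O₄.det), by simp [h₁, h₂, h₃, h₄], fun s => ?_, ?_⟩
  · rw [← det_stateMatrix_pencil, ← det_stateMatrix_pencil, hM]
    have hR := transpose_kronecker_mul_form_mul O₃ O₄
    have hL := kronecker_mul_form_mul_transpose O₁ O₂
    have hdet := det_kronecker_fin_two O₁ O₂
    generalize O₁ ⊗ₖ O₂ = L at hL hdet ⊢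
    generalize O₃ ⊗ₖ O₄ = R at hR ⊢
    generalize symplecticJ ⊗ₖ symplecticJ = K at hL hR ⊢
    generalize stateMatrix (Gvec v) = M
    generalize O₃.det * O₄.det = q at hR ⊢
    generalize O₁.det * O₂.det = l at hL hdet ⊢
    have key : L * M * R.transpose * K * (L * M * R.transpose).transpose - (l * q * s) • K =
        q • (L * (M * K * M.transpose - s • K) * L.transpose) := by
      calc _ = L * M * (R.transpose * K * R) * M.transpose * L.transpose - (q * s) • (l • K) := by
            simp only [Matrix.transpose_mul, Matrix.transpose_transpose, Matrix.mul_assoc,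
              smul_smul]
            congr 2
            ring
        _ = _ := by
            rw [hR, ← hL]
            simp only [Matrix.mul_sub, Matrix.sub_mul, Matrix.mul_smul, Matrix.smul_mul, smul_sub,
              smul_smul, Matrix.mul_assoc]
    rw [key, Matrix.det_smul, Matrix.det_mul, Matrix.det_mul, Matrix.det_transpose, hdet]
    simp only [Fintype.card_prod, Fintype.card_fin]
    ring
  · rw [← det_bellDiagonal, ← det_bellDiagonal, ← stateMatrix_Gvec, ← stateMatrix_Gvec, hM,
      Matrix.det_mul, Matrix.det_mul, Matrix.det_transpose, det_kronecker_fin_two,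
      det_kronecker_fin_two]
    ring

theorem exists_signs {ι : Type*} [Fintype ι] [DecidableEq ι] {u w : ι → ℂ}
    (hsq : ∀ i, w i ^ 2 = u i ^ 2) (hprod : ∏ i, w i = ∏ i, u i) :
    ∃ ε : ι → ℂ, (∀ i, ε i = 1 ∨ ε i = -1) ∧ ∏ i, ε i = 1 ∧ ∀ i, w i = ε i * u i := by
  have hex : ∀ i, ∃ e : ℂ, (e = 1 ∨ e = -1) ∧ w i = e * u i := fun i => by
    rcases sq_eq_sq_iff_eq_or_eq_neg.mp (hsq i) with h | h
    · exact ⟨1, .inl rfl, by simp [h]⟩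
    · exact ⟨-1, .inr rfl, by simp [h]⟩
  choose ε hε hw using hex
  by_cases hu : ∏ i, u i = 0
  · obtain ⟨j, -, hj⟩ := Finset.prod_eq_zero_iff.mp hu
    have hpm : ∏ i, ε i = 1 ∨ ∏ i, ε i = -1 := by
      rw [← sq_eq_one_iff, ← Finset.prod_pow]
      exact Finset.prod_eq_one fun i _ => sq_eq_one_iff.mpr (hε i)
    rcases hpm with h | h
    · exact ⟨ε, hε, h, hw⟩
    · refine ⟨ε * Pi.mulSingle j (-1), fun i => ?_, ?_, fun i => ?_⟩
      · rcases eq_or_ne i j with rfl | hij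
        · rcases hε i with h | h <;> simp [h]
        · simpa [hij] using hε i
      · simp [Finset.prod_mul_distrib, h]
      · rcases eq_or_ne i j with rfl | hij
        · simp [hw, hj]
        · simpa [hij] using hw i
  · refine ⟨ε, hε, mul_right_cancel₀ hu ?_, hw⟩
    rw [one_mul, ← Finset.prod_mul_distrib, ← hprod]
    exact Finset.prod_congr rfl fun i _ => (hw i).symm

theorem sloccEquiv_Gvec_iff {v w : Fin 4 → ℂ} (hinj : Function.Injective fun i => w i ^ 2) :
    SloccEquiv (Gvec v) (Gvec w) ↔
      ∃ (κ : ℂ) (σ : Equiv.Perm (Fin 4)) (ε : Fin 4 → ℂ),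
        κ ≠ 0 ∧ (∀ i, ε i = 1 ∨ ε i = -1) ∧ ∏ i, ε i = 1 ∧ ∀ i, w i = κ * (ε i * v (σ i)) := by
  constructor
  · intro h
    obtain ⟨p, hp, hpencil, hdet⟩ := h.exists_scalar
    have hroot : ∀ i, ∃ j, w i ^ 2 = p * v j ^ 2 := fun i => by
      have h₀ : ∏ k, (w k ^ 2 - p * (w i ^ 2 / p)) = 0 :=
        Finset.prod_eq_zero (Finset.mem_univ i) (by field_simp; ring)
      rw [hpencil, mul_eq_zero, or_iff_right (pow_ne_zero 4 hp), Finset.prod_eq_zero_iff] at h₀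
      obtain ⟨j, -, hj⟩ := h₀
      exact ⟨j, by rw [sub_eq_zero.mp hj]; field_simp⟩
    choose f hf using hroot
    have hf_inj : Function.Injective f := fun i j hij => hinj <| by
      simp only [hf, hij]
    let σ : Equiv.Perm (Fin 4) := Equiv.ofBijective f (Finite.injective_iff_bijective.mp hf_inj)
    obtain ⟨κ, hκ⟩ := IsAlgClosed.exists_pow_nat_eq p two_pos
    obtain ⟨ε, hε, hεprod, hw⟩ := exists_signs (u := fun i => κ * v (σ i)) (w := w)
      (fun i => by rw [hf, mul_pow, hκ]; rfl)
      (by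
        rw [hdet, Finset.prod_mul_distrib, Equiv.prod_comp σ v, ← hκ]
        simp [← pow_mul])
    refine ⟨κ, σ, ε, ?_, hε, hεprod, fun i => by rw [hw]; ring⟩
    rintro rfl
    exact hp (by simpa using hκ.symm)
  · rintro ⟨κ, σ, ε, hκ, hε, hprod, hw⟩
    have hσ : σ ∈ coeffPerms := coeffPerms_eq_top ▸ Submonoid.mem_top σ
    have hδ := mul_mem (const_mem_coeffScalings hκ) (signs_mem_coeffScalings hε hprod)
    have hw' : w = (fun _ => κ) * ε * (v ∘ σ) := funext fun i => by simp [hw, mul_assoc]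
    rw [hw']
    exact (hσ v).trans (hδ (v ∘ σ))

/-- Proposition 1: two generic states `G_{abcd}` and `G_{a'b'c'd'}` are SLOCC-equivalent
iff their coefficient tuples are related by an overall scalar, a permutation, and a change
of sign of an even number of coefficients. -/
theorem Gabcd_slocc_equiv_iff (a b c d a' b' c' d' : ℂ)
    (hab : a ^ 2 ≠ b ^ 2) (hac : a ^ 2 ≠ c ^ 2) (had : a ^ 2 ≠ d ^ 2)
    (hbc : b ^ 2 ≠ c ^ 2) (hbd : b ^ 2 ≠ d ^ 2) (hcd : c ^ 2 ≠ d ^ 2)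
    (hab' : a' ^ 2 ≠ b' ^ 2) (hac' : a' ^ 2 ≠ c' ^ 2) (had' : a' ^ 2 ≠ d' ^ 2)
    (hbc' : b' ^ 2 ≠ c' ^ 2) (hbd' : b' ^ 2 ≠ d' ^ 2) (hcd' : c' ^ 2 ≠ d' ^ 2) :
    (∃ O₁ O₂ O₃ O₄ : Matrix (Fin 2) (Fin 2) ℂ,
        IsUnit O₁ ∧ IsUnit O₂ ∧ IsUnit O₃ ∧ IsUnit O₄ ∧
        act4 O₁ O₂ O₃ O₄ (Gstate a b c d) = Gstate a' b' c' d') ↔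
    (∃ (κ : ℂ) (σ : Equiv.Perm (Fin 4)) (ε : Fin 4 → ℂ),
        κ ≠ 0 ∧ (∀ i, ε i = 1 ∨ ε i = -1) ∧ ε 0 * ε 1 * ε 2 * ε 3 = 1 ∧
        ∀ i, ![a', b', c', d'] i = κ * (ε i * ![a, b, c, d] (σ i))) := by
  have hinj : Function.Injective fun i => ![a', b', c', d'] i ^ 2 := by
    intro i j hij
    fin_cases i <;> fin_cases j <;> simp_all
  have h := sloccEquiv_Gvec_iff (v := ![a, b, c, d]) hinj
  simp only [Fin.prod_univ_four] at h
  exact h
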